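/- Let Y₀ be a compact subset of a locally compact metric space Y, and assume every compact subset of Y containing Y₀ has nonempty boundary in Y. Then Y \ Y₀ contains a connected component that is not relatively compact and whose closure in Y intersects Y₀. -/

import Mathlib

/-- `F` is not separated between `A` and `B`. -/
def WhyNS {X : Type*} [TopologicalSpace X] (A B F : Set X) : Prop :=
  ∀ P Q : Set X, IsClosed P → IsClosed Q → Disjoint P Q → A ⊆ P → B ⊆ Q → ¬ F ⊆ P ∪ Q

theorem why_exists_min {X : Type*} [TopologicalSpace X] [CompactSpace X] [T2Space X]
    (A B : Set X) (hA : IsClosed A) (hB : IsClosed B) (h : WhyNS A B Set.univ) :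
    ∃ M, Minimal (· ∈ {F : Set X | IsClosed F ∧ WhyNS A B F}) M := by
  apply zorn_superset
  intro c hc hch
  rcases c.eq_empty_or_nonempty with rfl | hne
  · exact ⟨Set.univ, ⟨isClosed_univ, h⟩, by simp⟩
  refine ⟨⋂₀ c, ⟨isClosed_sInter fun s hs => (hc hs).1, ?_⟩, fun s hs => Set.sInter_subset_of_mem hs⟩
  intro P Q hP hQ hd hAP hBQ hsub
  obtain ⟨U, V, hU, hV, hPU, hQV, hUV⟩ := normal_separation hP hQ hd
  haveI : Nonempty c := hne.to_subtype
  have hdir : Directed (· ⊇ ·) (fun i : c => (i : Set X)) := by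
    intro a b
    rcases hch.total a.2 b.2 with h | h
    · exact ⟨a, subset_rfl, h⟩
    · exact ⟨b, h, subset_rfl⟩
  obtain ⟨⟨F, hF⟩, hFs⟩ := exists_subset_nhds_of_compactSpace (U := U ∪ V) hdir
    (fun i => (hc i.2).1) (by
      intro x hx
      rw [← Set.sInter_eq_iInter] at hx
      exact (hU.union hV).mem_nhds (Set.union_subset_union hPU hQV (hsub hx)))
  have hFs' : F ⊆ U ∪ V := hFs
  refine (hc hF).2 (A ∪ (F \ V)) (B ∪ (F \ U)) (hA.union ((hc hF).1.sdiff hV))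
    (hB.union ((hc hF).1.sdiff hU)) ?_ Set.subset_union_left Set.subset_union_left ?_
  · rw [Set.disjoint_left] at *
    rintro x (h1 | h1) (h2 | h2)
    · exact hd (hAP h1) (hBQ h2)
    · exact h2.2 (hPU (hAP h1))
    · exact h1.2 (hQV (hBQ h2))
    · rcases hFs' h1.1 with h | h
      · exact h2.2 h
      · exact h1.2 h
  · intro x hx
    by_cases hxV : x ∈ V
    · exact Or.inr (Or.inr ⟨hx, fun hxU => Set.disjoint_left.1 hUV hxU hxV⟩)
    · exact Or.inl (Or.inr ⟨hx, hxV⟩)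

theorem why_main {X : Type*} [TopologicalSpace X] [CompactSpace X] [T2Space X]
    (A B : Set X) (hA : IsClosed A) (hB : IsClosed B) (hAB : Disjoint A B)
    (h : WhyNS A B Set.univ) :
    ∃ D : Set X, IsPreconnected D ∧ Disjoint D (A ∪ B) ∧ (closure D ∩ A).Nonempty ∧
      (closure D ∩ B).Nonempty := by
  obtain ⟨M, ⟨hMc, hM⟩, hmin⟩ := why_exists_min A B hA hB h
  have key : ∀ W : Set X, IsOpen W → (M ∩ W).Nonempty → ∃ P Q : Set X, IsClosed P ∧ IsClosed Q ∧
      Disjoint P Q ∧ A ⊆ P ∧ B ⊆ Q ∧ M \ W ⊆ P ∪ Q ∧ P ∪ Q ⊆ M \ W ∪ (A ∪ B) := by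
    intro W hW ⟨x, hxM, hxW⟩
    have hcl : IsClosed (M \ W) := hMc.sdiff hW
    have : ¬ WhyNS A B (M \ W) := fun hn =>
      (hmin (y := M \ W) ⟨hcl, hn⟩ Set.sdiff_subset hxM).2 hxW
    unfold WhyNS at this
    push Not at this
    obtain ⟨P, Q, hP, hQ, hd, hAP, hBQ, hs⟩ := this
    have hE : IsClosed (M \ W ∪ (A ∪ B)) := hcl.union (hA.union hB)
    refine ⟨P ∩ (M \ W ∪ (A ∪ B)), Q ∩ (M \ W ∪ (A ∪ B)), hP.inter hE, hQ.inter hE,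
      hd.mono Set.inter_subset_left Set.inter_subset_left,
      fun x hx => ⟨hAP hx, Or.inr (Or.inl hx)⟩, fun x hx => ⟨hBQ hx, Or.inr (Or.inr hx)⟩, ?_, ?_⟩
    · intro x hx
      exact (hs hx).imp (fun h => ⟨h, Or.inl hx⟩) (fun h => ⟨h, Or.inl hx⟩)
    · exact Set.union_subset Set.inter_subset_right Set.inter_subset_right
  refine ⟨M \ (A ∪ B), ?_, Set.disjoint_sdiff_left, ?_, ?_⟩
  · intro U V hU hV hsub ⟨x, hxM, hxU⟩ ⟨y, hyM, hyV⟩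
    by_contra hne
    obtain ⟨P, Q, hP, hQ, hd, hAP, hBQ, hs, hr⟩ := key V hV ⟨y, hyM.1, hyV⟩
    obtain ⟨P', Q', hP', hQ', hd', hAP', hBQ', hs', hr'⟩ := key U hU ⟨x, hxM.1, hxU⟩
    have both : ∀ z, z ∈ P ∪ Q → z ∈ P' ∪ Q' → z ∈ A ∪ B := by
      intro z h1 h2
      by_contra hz
      have h1 := (hr h1).resolve_right hz
      have h2 := (hr' h2).resolve_right hz
      exact (hsub ⟨h1.1, hz⟩).elim h2.2 h1.2
    rw [Set.disjoint_left] at hd hd'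
    refine hM (P ∪ P') (Q ∪ Q') (hP.union hP') (hQ.union hQ') ?_
      (hAP.trans Set.subset_union_left) (hBQ.trans Set.subset_union_left) ?_
    · rw [Set.disjoint_left]
      rintro z (h1 | h1) (h2 | h2)
      · exact hd h1 h2
      · rcases both z (Or.inl h1) (Or.inr h2) with h | h
        · exact hd' (hAP' h) h2
        · exact hd h1 (hBQ h)
      · rcases both z (Or.inr h2) (Or.inl h1) with h | h
        · exact hd (hAP h) h2
        · exact hd' h1 (hBQ' h)
      · exact hd' h1 h2
    · intro z hz
      by_cases hzV : z ∈ V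
      · by_cases hzU : z ∈ U
        · by_cases hzAB : z ∈ A ∪ B
          · exact hzAB.imp (fun h => Or.inl (hAP h)) (fun h => Or.inl (hBQ h))
          · exact (hne ⟨z, ⟨hz, hzAB⟩, hzU, hzV⟩).elim
        · exact (hs' ⟨hz, hzU⟩).imp Or.inr Or.inr
      · exact (hs ⟨hz, hzV⟩).imp Or.inl Or.inl
  · by_contra hne
    rw [Set.not_nonempty_iff_eq_empty, ← Set.disjoint_iff_inter_eq_empty] at hne
    refine hM A (B ∪ closure (M \ (A ∪ B))) hA (hB.union isClosed_closure)
      (Set.disjoint_union_right.2 ⟨hAB, hne.symm⟩) subset_rfl Set.subset_union_left ?_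
    intro z hz
    by_cases hzAB : z ∈ A ∪ B
    · exact hzAB.imp id Or.inl
    · exact Or.inr (Or.inr (subset_closure ⟨hz, hzAB⟩))
  · by_contra hne
    rw [Set.not_nonempty_iff_eq_empty, ← Set.disjoint_iff_inter_eq_empty] at hne
    refine hM (A ∪ closure (M \ (A ∪ B))) B (hA.union isClosed_closure) hB
      (Set.disjoint_union_left.2 ⟨hAB, hne⟩) Set.subset_union_left subset_rfl ?_
    intro z hz
    by_cases hzAB : z ∈ A ∪ B
    · exact hzAB.imp Or.inl id
    · exact Or.inl (Or.inr (subset_closure ⟨hz, hzAB⟩))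

/-- Whyburn-type lemma: if `Y₀` is a compact subset of a locally compact metric space `Y`
such that every compact subset of `Y` containing `Y₀` has nonempty boundary, then `Y \ Y₀`
contains a connected component that is not relatively compact and whose closure in `Y`
intersects `Y₀`. -/
theorem whyburn_lemma {Y : Type*} [MetricSpace Y] [LocallyCompactSpace Y]
    (Y₀ : Set Y) (hY₀ : IsCompact Y₀)
    (hbd : ∀ K : Set Y, IsCompact K → Y₀ ⊆ K → (frontier K).Nonempty) :
    ∃ x ∈ Y₀ᶜ, ¬ IsCompact (closure (connectedComponentIn Y₀ᶜ x)) ∧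
      (closure (connectedComponentIn Y₀ᶜ x) ∩ Y₀).Nonempty := by
  have hemb := OnePoint.isOpenEmbedding_coe (X := Y)
  let f : Y → OnePoint Y := (↑)
  have hinf : ∀ y : Y, f y ≠ OnePoint.infty := OnePoint.coe_ne_infty
  have hfr : ∀ z : OnePoint Y, z ≠ OnePoint.infty → z ∈ Set.range f := by
    intro z hz
    obtain ⟨y, rfl⟩ := OnePoint.ne_infty_iff_exists.1 hz
    exact ⟨y, rfl⟩
  change Topology.IsOpenEmbedding f at hemb
  have hcompl : IsClosed (f '' Y₀) := (hY₀.image hemb.continuous).isClosed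
  obtain ⟨D, hD, hdis, hDA, hDB⟩ := why_main (f '' Y₀) {OnePoint.infty} hcompl
    isClosed_singleton (by
      rw [Set.disjoint_singleton_right]
      rintro ⟨y, -, hy⟩
      exact hinf y hy) (by
    intro P Q hP hQ hd hAP hBQ hsub
    rw [Set.disjoint_left] at hd
    have hPr : P ⊆ Set.range f := fun z hz => hfr z (by
      rintro rfl
      exact hd hz (hBQ rfl))
    have hK : IsCompact (f ⁻¹' P) :=
      (hemb.isInducing.isCompact_preimage_iff hPr).2 hP.isCompact
    have hPo : IsOpen P := by
      have : P = Qᶜ := by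
        ext z
        exact ⟨fun h1 h2 => hd h1 h2, fun h => (hsub (Set.mem_univ z)).resolve_right h⟩
      rw [this]
      exact hQ.isOpen_compl
    have hcl : IsClopen (f ⁻¹' P) := IsClopen.preimage ⟨hP, hPo⟩ hemb.continuous
    have := hbd _ hK (Set.image_subset_iff.1 hAP)
    rw [hcl.frontier_eq] at this
    exact Set.not_nonempty_empty this)
  rw [Set.disjoint_left] at hdis
  have hDr : D ⊆ Set.range f := fun z hz => hfr z (fun h => hdis hz (Or.inr h))
  have himg : f '' (f ⁻¹' D) = D := Set.image_preimage_eq_of_subset hDr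
  have hpre : IsPreconnected (f ⁻¹' D) := by
    rw [← hemb.isInducing.isPreconnected_image, himg]
    exact hD
  have hsubc : f ⁻¹' D ⊆ Y₀ᶜ := fun y hy hy0 => hdis hy (Or.inl ⟨y, hy0, rfl⟩)
  obtain ⟨z, hz⟩ : D.Nonempty := closure_nonempty_iff.1 (hDA.mono Set.inter_subset_left)
  obtain ⟨x, rfl⟩ := hDr hz
  have hxD : x ∈ f ⁻¹' D := hz
  have hC := hpre.subset_connectedComponentIn hxD hsubc
  refine ⟨x, hsubc hxD, fun hcomp => ?_, ?_⟩
  · have h1 : IsClosed (f '' closure (connectedComponentIn Y₀ᶜ x)) :=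
      (hcomp.image hemb.continuous).isClosed
    have h2 : closure D ⊆ f '' closure (connectedComponentIn Y₀ᶜ x) := by
      apply closure_minimal _ h1
      rw [← himg]
      exact Set.image_mono (hC.trans subset_closure)
    obtain ⟨w, hw, hw'⟩ := hDB
    obtain ⟨y, -, hy⟩ := h2 hw
    exact hinf y (hy.trans hw')
  · obtain ⟨_, hw, y, hy, rfl⟩ := hDA
    refine ⟨y, closure_mono hC ?_, hy⟩
    rw [hemb.isInducing.closure_eq_preimage_closure_image, himg]
    exact hw
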